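/- For every real r > 1 there exists n_0 such that the following holds for all positive integers k, ℓ, m with n = ℓ(k+m)+1 ≥ n_0: let κ = max{3k, 70·r⁴·log n}; if ℓ ≥ 70·r⁴·κ·log n and m ≥ 6·r²·κ, then for every fixed initial mutant x_0 lying in one of the reservoirs R_1∪…∪R_ℓ, the discrete-time Moran process with fitness r on the (k,ℓ,m)-superstar started from the state {x_0} has extinction probability at least 1/(490·r⁴·κ). -/

import Mathlib

open Finset

/-- Total fitness of the mutant set `S` (mutants have fitness `r`, non-mutants fitness `1`). -/
noncomputable def moranW {V : Type*} [Fintype V] (r : ℝ) (S : Finset V) : ℝ :=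
  r * S.card + ((Fintype.card V : ℝ) - S.card)

/-- One-step transition probability of the Moran process with fitness `r` and
reproduction weights `w`, from mutant set `S` to mutant set `T`:  a vertex `u` is chosen
with probability `r / moranW r S` if it is a mutant and `1 / moranW r S` otherwise, then a
target `v` is chosen with probability `w u v`, and `v` becomes a mutant if `u` is one and
a non-mutant otherwise. -/
noncomputable def moranStep {V : Type*} [Fintype V] [DecidableEq V]
    (r : ℝ) (w : V → V → ℝ) (S T : Finset V) : ℝ :=
  ∑ u : V, ∑ v : V,
    ((if u ∈ S then r else 1) / moranW r S) * w u v *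
      (if (if u ∈ S then insert v S else S.erase v) = T then 1 else 0)

/-- Distribution of the Moran process after `t` steps, from initial distribution `init`. -/
noncomputable def moranDist {V : Type*} [Fintype V] [DecidableEq V]
    (r : ℝ) (w : V → V → ℝ) (init : Finset V → ℝ) : ℕ → Finset V → ℝ
  | 0 => init
  | t + 1 => fun T => ∑ S : Finset V, moranDist r w init t S * moranStep r w S T

/-- Reproduction weights of the (unweighted) Moran process on the digraph with
out-neighbourhoods `out`: the offspring goes to a uniformly random out-neighbour. -/
noncomputable def outWeights {V : Type*} [DecidableEq V]
    (out : V → Finset V) : V → V → ℝ :=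
  fun u v => if v ∈ out u then ((out u).card : ℝ)⁻¹ else 0

/-- Extinction probability: `sup_t Pr(S_t = ∅)`. -/
noncomputable def extinctionProb {V : Type*} [Fintype V] [DecidableEq V]
    (r : ℝ) (w : V → V → ℝ) (init : Finset V → ℝ) : ℝ :=
  ⨆ t : ℕ, moranDist r w init t (∅ : Finset V)

/-- Fixation probability: `sup_t Pr(S_t = V)`. -/
noncomputable def fixationProb {V : Type*} [Fintype V] [DecidableEq V]
    (r : ℝ) (w : V → V → ℝ) (init : Finset V → ℝ) : ℝ :=
  ⨆ t : ℕ, moranDist r w init t (Finset.univ : Finset V)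

/-- Initial distribution: a single mutant at a uniformly random vertex. -/
noncomputable def uniformSingleton (V : Type*) [Fintype V] [DecidableEq V] :
    Finset V → ℝ :=
  fun S => if S.card = 1 then (Fintype.card V : ℝ)⁻¹ else 0

/-- Initial distribution: a single mutant at the fixed vertex `x₀`. -/
def pointInit {V : Type*} [DecidableEq V] (x₀ : V) : Finset V → ℝ :=
  fun S => if S = {x₀} then 1 else 0

/-- Vertices of the `(k,ℓ,m)`-superstar: `ℓ` reservoirs `R_i` of size `m`
(`Sum.inl (i, x)`), path vertices `v_{i,j}` for `i ∈ [ℓ]`, `j ∈ [k]`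
(`Sum.inr (Sum.inl (i, j))`), and the centre vertex `v*` (`Sum.inr (Sum.inr ())`).
It has `ℓ * (k + m) + 1` vertices. -/
abbrev SuperstarV (k ℓ m : ℕ) : Type :=
  (Fin ℓ × Fin m) ⊕ ((Fin ℓ × Fin k) ⊕ Unit)

/-- Out-neighbourhoods of the `(k,ℓ,m)`-superstar: the centre points to every reservoir
vertex, each vertex of `R_i` points to `v_{i,1}`, each `v_{i,j}` points to `v_{i,j+1}`
for `j < k`, and `v_{i,k}` points to the centre. -/
def superstarOut (k ℓ m : ℕ) : SuperstarV k ℓ m → Finset (SuperstarV k ℓ m)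
  | Sum.inl (i, _) =>
      if h : 0 < k then {Sum.inr (Sum.inl (i, ⟨0, h⟩))} else {Sum.inr (Sum.inr ())}
  | Sum.inr (Sum.inl (i, j)) =>
      if h : (j : ℕ) + 1 < k then {Sum.inr (Sum.inl (i, ⟨(j : ℕ) + 1, h⟩))}
      else {Sum.inr (Sum.inr ())}
  | Sum.inr (Sum.inr _) =>
      (Finset.univ : Finset (Fin ℓ × Fin m)).image fun p => Sum.inl p

section GeneralMoran

variable {V : Type*} [Fintype V] [DecidableEq V]

/-- The next state when `u` reproduces onto `v`. -/
def nextState (S : Finset V) (u v : V) : Finset V :=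
  if u ∈ S then insert v S else S.erase v

/-- Expected value of `f` after one step. -/
noncomputable def stepExp (r : ℝ) (w : V → V → ℝ) (f : Finset V → ℝ) (S : Finset V) : ℝ :=
  ∑ u : V, ∑ v : V, ((if u ∈ S then r else 1) / moranW r S) * w u v * f (nextState S u v)

lemma sum_step_mul (r : ℝ) (w : V → V → ℝ) (f : Finset V → ℝ) (S : Finset V) :
    ∑ T : Finset V, moranStep r w S T * f T = stepExp r w f S := by
  unfold moranStep stepExp nextState
  simp_rw [Finset.sum_mul]
  rw [Finset.sum_comm]
  refine Finset.sum_congr rfl fun u _ => ?_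
  rw [Finset.sum_comm]
  refine Finset.sum_congr rfl fun v _ => ?_
  simp [mul_ite, ite_mul]

lemma sum_fit (r : ℝ) (S : Finset V) :
    ∑ u : V, (if u ∈ S then r else 1) = moranW r S := by
  unfold moranW
  rw [Finset.sum_ite]
  have h1 : (Finset.univ.filter (fun u => u ∈ S)) = S := by ext; simp
  have h2 : (Finset.univ.filter (fun u => u ∉ S)) = Sᶜ := by ext; simp
  rw [h1, h2, Finset.sum_const, Finset.sum_const, Finset.card_compl,
    nsmul_eq_mul, nsmul_eq_mul, Nat.cast_sub (Finset.card_le_univ S)]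
  ring

lemma moranW_pos [Nonempty V] {r : ℝ} (hr : 1 < r) (S : Finset V) : 0 < moranW r S := by
  rw [← sum_fit]
  apply Finset.sum_pos
  · intro u _
    split_ifs <;> linarith
  · exact Finset.univ_nonempty

lemma moranDist_nonneg [Nonempty V] {r : ℝ} (hr : 1 < r) {w : V → V → ℝ}
    (hw : ∀ u v, 0 ≤ w u v) {init : Finset V → ℝ} (hi : ∀ S, 0 ≤ init S) (t : ℕ) (S : Finset V) :
    0 ≤ moranDist r w init t S := by
  induction t generalizing S with
  | zero => exact hi S
  | succ t ih =>
    simp only [moranDist]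
    refine Finset.sum_nonneg fun T _ => mul_nonneg (ih T) ?_
    unfold moranStep
    refine Finset.sum_nonneg fun u _ => Finset.sum_nonneg fun v _ => ?_
    refine mul_nonneg (mul_nonneg (div_nonneg ?_ (moranW_pos hr T).le) (hw u v)) ?_
    · split_ifs <;> linarith
    · split_ifs <;> norm_num

lemma moranDist_exp_succ (r : ℝ) (w : V → V → ℝ) (init f : Finset V → ℝ) (t : ℕ) :
    ∑ T, moranDist r w init (t + 1) T * f T
      = ∑ S, moranDist r w init t S * stepExp r w f S := by
  simp only [moranDist]
  simp_rw [Finset.sum_mul]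
  rw [Finset.sum_comm]
  refine Finset.sum_congr rfl fun S _ => ?_
  rw [← sum_step_mul, Finset.mul_sum]
  refine Finset.sum_congr rfl fun T _ => ?_
  ring

lemma stepExp_eq {r : ℝ} {w : V → V → ℝ} (f : Finset V → ℝ) (S : Finset V) :
    stepExp r w f S = (∑ u : V, (if u ∈ S then r else 1) *
      ∑ v : V, w u v * f (nextState S u v)) / moranW r S := by
  unfold stepExp
  rw [Finset.sum_div]
  refine Finset.sum_congr rfl fun u _ => ?_
  rw [Finset.mul_sum, Finset.sum_div]
  refine Finset.sum_congr rfl fun v _ => ?_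
  ring

lemma moranDist_sum [Nonempty V] {r : ℝ} (hr : 1 < r) {w : V → V → ℝ}
    (hw1 : ∀ u, ∑ v, w u v = 1) {init : Finset V → ℝ}
    (hi1 : ∑ S, init S = 1) (t : ℕ) :
    ∑ S, moranDist r w init t S = 1 := by
  induction t with
  | zero => exact hi1
  | succ t ih =>
    have := moranDist_exp_succ r w init (fun _ => 1) t
    simp only [mul_one] at this
    rw [this]
    refine Eq.trans ?_ ih
    refine Finset.sum_congr rfl fun S _ => ?_
    rw [stepExp_eq]
    simp only [mul_one, hw1, sum_fit]
    rw [div_self (moranW_pos hr S).ne', mul_one]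

/-- Submartingale criterion for lower-bounding the extinction probability. -/
lemma le_extinctionProb [Nonempty V] {r : ℝ} (hr : 1 < r) {w : V → V → ℝ}
    (hw : ∀ u v, 0 ≤ w u v) (hw1 : ∀ u, ∑ v, w u v = 1) (x₀ : V)
    (f : Finset V → ℝ) (hf0 : ∀ S, 0 ≤ f S) (hf1 : ∀ S, f S ≤ 1)
    (hemp : f ∅ ≤ stepExp r w f ∅)
    (hdrift : ∀ S, S ≠ ∅ → 0 < f S → f S < stepExp r w f S) :
    f {x₀} ≤ extinctionProb r w (pointInit x₀) := by
  classical
  set μ := moranDist r w (pointInit x₀) with hμ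
  have hi : ∀ S, 0 ≤ pointInit x₀ S := by
    intro S; unfold pointInit; split_ifs <;> norm_num
  have hi1 : ∑ S, pointInit x₀ S = 1 := by simp [pointInit]
  have hμ0 : ∀ t S, 0 ≤ μ t S := fun t S => moranDist_nonneg hr hw hi t S
  have hμ1 : ∀ t, ∑ S, μ t S = 1 := fun t => moranDist_sum hr hw1 hi1 t
  have hle1 : ∀ t S, μ t S ≤ 1 := fun t S => by
    rw [← hμ1 t]
    exact Finset.single_le_sum (fun T _ => hμ0 t T) (Finset.mem_univ S)
  have hbdd : BddAbove (Set.range fun t => μ t ∅) := ⟨1, by rintro _ ⟨t, rfl⟩; exact hle1 t ∅⟩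
  have hsup : ∀ t, μ t ∅ ≤ extinctionProb r w (pointInit x₀) := fun t => le_ciSup hbdd t
  by_contra hcon
  push Not at hcon
  set q := extinctionProb r w (pointInit x₀)
  set δ := f {x₀} - q with hδ
  have hδ0 : 0 < δ := by linarith
  set G : Finset (Finset V) := Finset.univ.filter (fun S => S ≠ ∅ ∧ 0 < f S) with hG
  obtain ⟨ε, hε, hεG⟩ : ∃ ε : ℝ, 0 < ε ∧ ∀ S ∈ G, f S + ε ≤ stepExp r w f S := by
    rcases G.eq_empty_or_nonempty with h | h
    · exact ⟨1, one_pos, by simp [h]⟩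
    · obtain ⟨S, hS, hmin⟩ := G.exists_min_image (fun S => stepExp r w f S - f S) h
      have hS' := (Finset.mem_filter.1 hS).2
      refine ⟨stepExp r w f S - f S, sub_pos.2 (hdrift S hS'.1 hS'.2), fun T hT => ?_⟩
      have := hmin T hT
      linarith
  have hstep0 : ∀ S, 0 ≤ stepExp r w f S := by
    intro S
    unfold stepExp
    refine Finset.sum_nonneg fun u _ => Finset.sum_nonneg fun v _ => ?_
    refine mul_nonneg (mul_nonneg (div_nonneg ?_ (moranW_pos hr S).le) (hw u v)) (hf0 _)
    split_ifs <;> linarith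
  have hall : ∀ S, f S + (if S ∈ G then ε else 0) ≤ stepExp r w f S := by
    intro S
    split_ifs with h
    · exact hεG S h
    · simp only [hG, Finset.mem_filter, Finset.mem_univ, true_and, not_and, not_lt] at h
      by_cases hS : S = ∅
      · rw [hS]; linarith
      · linarith [h hS, hstep0 S]
  have hpt : ∀ S, f S ≤ (if S = ∅ then 1 else 0) + (if S ∈ G then 1 else 0) := by
    intro S
    by_cases hS : S = ∅
    · rw [if_pos hS]; split_ifs <;> linarith [hf1 S]
    · rw [if_neg hS]
      split_ifs with h
      · linarith [hf1 S]
      · simp only [hG, Finset.mem_filter, Finset.mem_univ, true_and, not_and, not_lt] at h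
        linarith [h hS]
  have hE0 : ∑ S, μ 0 S * f S = f {x₀} := by
    simp [hμ, moranDist, pointInit]
  have hstep : ∀ t, ∑ S, μ t S * f S + ε * (∑ S, μ t S * (if S ∈ G then 1 else 0))
      ≤ ∑ S, μ (t + 1) S * f S := by
    intro t
    rw [hμ, moranDist_exp_succ, ← hμ, Finset.mul_sum, ← Finset.sum_add_distrib]
    refine Finset.sum_le_sum fun S _ => ?_
    have := mul_le_mul_of_nonneg_left (hall S) (hμ0 t S)
    split_ifs at this ⊢ <;> linarith
  have hEle : ∀ t, ∑ S, μ t S * f S ≤ q + ∑ S, μ t S * (if S ∈ G then 1 else 0) := by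
    intro t
    have h1 : ∑ S, μ t S * f S
        ≤ ∑ S, μ t S * ((if S = ∅ then 1 else 0) + (if S ∈ G then 1 else 0)) :=
      Finset.sum_le_sum fun S _ => mul_le_mul_of_nonneg_left (hpt S) (hμ0 t S)
    simp_rw [mul_add] at h1
    rw [Finset.sum_add_distrib] at h1
    have h2 : ∑ S, μ t S * (if S = ∅ then (1:ℝ) else 0) = μ t ∅ := by simp
    linarith [hsup t]
  have hgrow : ∀ t : ℕ, f {x₀} + t * (ε * δ) ≤ ∑ S, μ t S * f S := by
    intro t
    induction t with
    | zero => simp [hE0]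
    | succ t ih =>
      have h1 := hstep t
      have h2 := hEle t
      have h3 : 0 ≤ (t:ℝ) * (ε * δ) := by positivity
      have h4 : δ ≤ ∑ S, μ t S * (if S ∈ G then 1 else 0) := by linarith
      have h5 := mul_le_mul_of_nonneg_left h4 hε.le
      push_cast
      linarith
  have hub : ∀ t, ∑ S, μ t S * f S ≤ 1 := by
    intro t
    rw [← hμ1 t]
    refine Finset.sum_le_sum fun S _ => ?_
    have := mul_le_mul_of_nonneg_left (hf1 S) (hμ0 t S)
    linarith
  obtain ⟨t, ht⟩ := exists_nat_gt (1 / (ε * δ))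
  have hεδ : 0 < ε * δ := mul_pos hε hδ0
  rw [div_lt_iff₀ hεδ] at ht
  linarith [hgrow t, hub t, hf0 {x₀}]

lemma outWeights_nonneg (out : V → Finset V) (u v : V) : 0 ≤ outWeights out u v := by
  unfold outWeights; split_ifs
  · positivity
  · exact le_rfl

lemma outWeights_sum (out : V → Finset V) (g : V → ℝ) (u : V) :
    ∑ v, outWeights out u v * g v = ((out u).card : ℝ)⁻¹ * ∑ v ∈ out u, g v := by
  unfold outWeights
  simp only [ite_mul, zero_mul]
  rw [Finset.sum_ite_mem, Finset.univ_inter, Finset.mul_sum]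

lemma drift_of_sum_pos [Nonempty V] {r : ℝ} (hr : 1 < r) {w : V → V → ℝ}
    (f : Finset V → ℝ) (S : Finset V)
    (h : 0 < ∑ u : V, (if u ∈ S then r else 1) *
      (∑ v : V, w u v * f (nextState S u v) - f S)) :
    f S < stepExp r w f S := by
  rw [stepExp_eq, lt_div_iff₀ (moranW_pos hr S), ← sum_fit, Finset.mul_sum]
  simp_rw [mul_sub] at h
  rw [Finset.sum_sub_distrib, sub_pos] at h
  simpa only [mul_comm (f S)] using h

end GeneralMoran

section SuperstarPotential

variable {k ℓ m : ℕ}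

/-- path vertex -/
abbrev pv (k ℓ m : ℕ) (i : Fin ℓ) (j : Fin k) : SuperstarV k ℓ m := Sum.inr (Sum.inl (i, j))

/-- centre vertex -/
abbrev cv (k ℓ m : ℕ) : SuperstarV k ℓ m := Sum.inr (Sum.inr ())

/-- reservoir vertex -/
abbrev rv (k ℓ m : ℕ) (i : Fin ℓ) (x : Fin m) : SuperstarV k ℓ m := Sum.inl (i, x)

/-- states whose mutants lie in `{x₀}`, the path of `x₀` and the centre -/
def GoodState (i : Fin ℓ) (x : Fin m) (S : Finset (SuperstarV k ℓ m)) : Prop :=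
  ∀ u ∈ S, u = rv k ℓ m i x ∨ (∃ j, u = pv k ℓ m i j) ∨ u = cv k ℓ m

/-- distance of the rearmost mutant (not counting the first path vertex) from the path's end -/
def rho (i : Fin ℓ) (S : Finset (SuperstarV k ℓ m)) : ℕ :=
  (Finset.univ.filter (fun j : Fin k => 0 < (j : ℕ) ∧ pv k ℓ m i j ∈ S)).sup
    (fun j => k - (j : ℕ))

lemma rho_mono {i : Fin ℓ} {S T : Finset (SuperstarV k ℓ m)}
    (h : ∀ j : Fin k, 0 < (j : ℕ) → pv k ℓ m i j ∈ S → pv k ℓ m i j ∈ T) :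
    rho i S ≤ rho i T := by
  unfold rho
  apply Finset.sup_mono
  intro j
  simp only [Finset.mem_filter, Finset.mem_univ, true_and]
  exact fun hj => ⟨hj.1, h j hj.1 hj.2⟩

lemma rho_congr {i : Fin ℓ} {S T : Finset (SuperstarV k ℓ m)}
    (h : ∀ j : Fin k, 0 < (j : ℕ) → (pv k ℓ m i j ∈ S ↔ pv k ℓ m i j ∈ T)) :
    rho i S = rho i T :=
  le_antisymm (rho_mono fun j hj => (h j hj).1) (rho_mono fun j hj => (h j hj).2)

lemma rho_le (i : Fin ℓ) (S : Finset (SuperstarV k ℓ m)) : rho i S ≤ k := by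
  unfold rho
  exact Finset.sup_le fun j _ => Nat.sub_le _ _

lemma le_rho {i : Fin ℓ} {S : Finset (SuperstarV k ℓ m)} {j : Fin k} (hj : 0 < (j : ℕ))
    (hS : pv k ℓ m i j ∈ S) : k - (j : ℕ) ≤ rho i S := by
  unfold rho
  exact Finset.le_sup (f := fun j : Fin k => k - (j : ℕ)) (by simp [hj, hS])

/-- inserting `v_{j+1}` next to a mutant `v_j`, `j ≥ 1`, does not change `rho` -/
lemma rho_insert {i : Fin ℓ} {S : Finset (SuperstarV k ℓ m)} {j j' : Fin k} (hj : 0 < (j : ℕ))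
    (hS : pv k ℓ m i j ∈ S) (hj' : (j' : ℕ) = j + 1) :
    rho i (insert (pv k ℓ m i j') S) = rho i S := by
  apply le_antisymm
  · conv_lhs => unfold rho
    apply Finset.sup_le
    intro b hb
    simp only [Finset.mem_filter, Finset.mem_univ, true_and, Finset.mem_insert] at hb
    rcases hb with ⟨hb0, hb | hb⟩
    · have : b = j' := by simpa [pv] using hb
      subst this
      have := le_rho hj hS
      omega
    · exact le_rho hb0 hb
  · exact rho_mono fun b _ hb => Finset.mem_insert_of_mem hb

/-- if there is a later mutant and `v_0` is not a mutant, then there is a rear -/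
lemma exists_rear {i : Fin ℓ} {S : Finset (SuperstarV k ℓ m)} (hk : 0 < k)
    (h0 : pv k ℓ m i ⟨0, hk⟩ ∉ S) (h1 : ∃ j, pv k ℓ m i j ∈ S) :
    ∃ j : Fin k, ∃ h : (j : ℕ) + 1 < k, pv k ℓ m i j ∉ S ∧
      rho i (S.erase (pv k ℓ m i ⟨j + 1, h⟩)) + 1 ≤ rho i S := by
  classical
  have h2 : ∃ a : ℕ, ∃ h : a < k, pv k ℓ m i ⟨a, h⟩ ∈ S := by
    obtain ⟨j, hj⟩ := h1
    exact ⟨j, j.2, hj⟩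
  obtain ⟨ha, haS⟩ := Nat.find_spec h2
  have hmin := fun b (hb : b < Nat.find h2) => Nat.find_min h2 hb
  generalize Nat.find h2 = a at ha haS hmin
  have ha0 : a ≠ 0 := by
    rintro rfl
    exact h0 haS
  obtain ⟨b, rfl⟩ := Nat.exists_eq_succ_of_ne_zero ha0
  refine ⟨⟨b, by omega⟩, ha, ?_, ?_⟩
  · intro hb
    exact hmin b (by omega) ⟨_, hb⟩
  · have hr : k - (b + 1) ≤ rho i S := le_rho (j := ⟨b + 1, ha⟩) (by simp) haS
    have : rho i (S.erase (pv k ℓ m i ⟨b + 1, ha⟩)) ≤ k - (b + 2) := by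
      unfold rho
      apply Finset.sup_le
      intro c hc
      simp only [Finset.mem_filter, Finset.mem_univ, true_and, Finset.mem_erase] at hc
      have h3 : ¬ (c : ℕ) < b + 1 := fun h => hmin c h ⟨c.2, hc.2.2⟩
      have h4 : (c : ℕ) ≠ b + 1 := by
        intro h
        apply hc.2.1
        have : c = ⟨b + 1, ha⟩ := Fin.ext h
        rw [this]
      omega
    have : b + 1 < k := ha
    change rho i (S.erase (pv k ℓ m i ⟨b + 1, ha⟩)) + 1 ≤ rho i S
    omega

/-- the path/centre part of the potential -/
noncomputable def hpot (hk : 0 < k) (A D β : ℝ) (i : Fin ℓ) (S : Finset (SuperstarV k ℓ m)) : ℝ :=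
  1 - A * rho i S - (if pv k ℓ m i ⟨0, hk⟩ ∈ S then D else 0)
    - (if cv k ℓ m ∈ S then β else 0)

/-- reservoir factor -/
noncomputable def qpot (p : ℝ) (i : Fin ℓ) (x : Fin m) (S : Finset (SuperstarV k ℓ m)) : ℝ :=
  if rv k ℓ m i x ∈ S then p else 1

open Classical in
/-- the potential -/
noncomputable def fpot (hk : 0 < k) (p A D β : ℝ) (i : Fin ℓ) (x : Fin m)
    (S : Finset (SuperstarV k ℓ m)) : ℝ :=
  if GoodState i x S then qpot p i x S * hpot hk A D β i S else 0

/-- one-vertex expected change -/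
noncomputable def dlt (hk : 0 < k) (p A D β : ℝ) (i : Fin ℓ) (x : Fin m)
    (S : Finset (SuperstarV k ℓ m)) (u : SuperstarV k ℓ m) : ℝ :=
  ∑ v, outWeights (superstarOut k ℓ m) u v * fpot hk p A D β i x (nextState S u v)
    - fpot hk p A D β i x S

lemma dlt_single {hk : 0 < k} {p A D β : ℝ} {i : Fin ℓ} {x : Fin m}
    {S : Finset (SuperstarV k ℓ m)} {u y : SuperstarV k ℓ m} (h : superstarOut k ℓ m u = {y}) :
    dlt hk p A D β i x S u
      = fpot hk p A D β i x (nextState S u y) - fpot hk p A D β i x S := by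
  unfold dlt
  rw [outWeights_sum, h]
  simp

lemma dlt_centre {hk : 0 < k} {p A D β : ℝ} {i : Fin ℓ} {x : Fin m}
    {S : Finset (SuperstarV k ℓ m)} :
    dlt hk p A D β i x S (cv k ℓ m)
      = ((ℓ : ℝ) * m)⁻¹ * ∑ b : Fin ℓ × Fin m, fpot hk p A D β i x (nextState S (cv k ℓ m) (Sum.inl b))
        - fpot hk p A D β i x S := by
  unfold dlt
  rw [outWeights_sum]
  have : superstarOut k ℓ m (cv k ℓ m)
      = (Finset.univ : Finset (Fin ℓ × Fin m)).image fun p => Sum.inl p := rfl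
  rw [this, Finset.card_image_of_injective _ Sum.inl_injective,
    Finset.sum_image (fun _ _ _ _ h => Sum.inl_injective h)]
  simp

lemma out_rv (hk : 0 < k) (i : Fin ℓ) (x : Fin m) :
    superstarOut k ℓ m (rv k ℓ m i x) = {pv k ℓ m i ⟨0, hk⟩} := by
  simp [superstarOut, hk]

lemma out_pv (i : Fin ℓ) (j : Fin k) (h : (j : ℕ) + 1 < k) :
    superstarOut k ℓ m (pv k ℓ m i j) = {pv k ℓ m i ⟨j + 1, h⟩} := by
  simp [superstarOut, h]

lemma out_pv_last (i : Fin ℓ) (j : Fin k) (h : ¬ (j : ℕ) + 1 < k) :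
    superstarOut k ℓ m (pv k ℓ m i j) = {cv k ℓ m} := by
  simp [superstarOut, h]

lemma superstar_row (hℓ : 0 < ℓ) (hm : 0 < m) (u : SuperstarV k ℓ m) :
    ∑ v, outWeights (superstarOut k ℓ m) u v = 1 := by
  have := outWeights_sum (superstarOut k ℓ m) (fun _ => 1) u
  simp only [mul_one, Finset.sum_const, nsmul_eq_mul] at this
  rw [this]
  apply inv_mul_cancel₀
  have : (superstarOut k ℓ m u).Nonempty := by
    rcases u with ⟨i, x⟩ | ⟨i, j⟩ | u
    · by_cases h : 0 < k <;> simp [superstarOut, h]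
    · by_cases h : (j : ℕ) + 1 < k <;> simp [superstarOut, h]
    · exact ⟨Sum.inl (⟨0, hℓ⟩, ⟨0, hm⟩), by simp [superstarOut]⟩
  exact_mod_cast this.card_pos.ne'

lemma good_erase {i : Fin ℓ} {x : Fin m} {S : Finset (SuperstarV k ℓ m)}
    (h : GoodState i x S) (v) : GoodState i x (S.erase v) :=
  fun u hu => h u (Finset.mem_of_mem_erase hu)

lemma good_insert_pv {i : Fin ℓ} {x : Fin m} {S : Finset (SuperstarV k ℓ m)}
    (h : GoodState i x S) (j) : GoodState i x (insert (pv k ℓ m i j) S) := by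
  intro u hu
  rcases Finset.mem_insert.1 hu with rfl | hu
  · exact Or.inr (Or.inl ⟨j, rfl⟩)
  · exact h u hu

lemma good_insert_cv {i : Fin ℓ} {x : Fin m} {S : Finset (SuperstarV k ℓ m)}
    (h : GoodState i x S) : GoodState i x (insert (cv k ℓ m) S) := by
  intro u hu
  rcases Finset.mem_insert.1 hu with rfl | hu
  · exact Or.inr (Or.inr rfl)
  · exact h u hu

lemma good_rv {i i' : Fin ℓ} {x x' : Fin m} {S : Finset (SuperstarV k ℓ m)}
    (h : GoodState i x S) (hu : rv k ℓ m i' x' ∈ S) : i' = i ∧ x' = x := by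
  have := h _ hu
  simpa [rv, pv, cv] using this

lemma good_pv {i i' : Fin ℓ} {x : Fin m} {j : Fin k} {S : Finset (SuperstarV k ℓ m)}
    (h : GoodState i x S) (hu : pv k ℓ m i' j ∈ S) : i' = i := by
  have := h _ hu
  simp [rv, pv, cv] at this
  exact this


lemma hpot_le_one (hk : 0 < k) {A D β : ℝ} (hA : 0 ≤ A) (hD : 0 ≤ D) (hβ : 0 ≤ β)
    (i : Fin ℓ) (S : Finset (SuperstarV k ℓ m)) : hpot hk A D β i S ≤ 1 := by
  unfold hpot
  have : 0 ≤ A * (rho i S : ℝ) := by positivity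
  split_ifs <;> linarith

lemma half_le_hpot (hk : 0 < k) {A D β : ℝ} (hA : 0 ≤ A) (hD : 0 ≤ D) (hβ : 0 ≤ β)
    (hs : A * k + D + β ≤ 1 / 2)
    (i : Fin ℓ) (S : Finset (SuperstarV k ℓ m)) : 1 / 2 ≤ hpot hk A D β i S := by
  unfold hpot
  have h1 : (rho i S : ℝ) ≤ k := by exact_mod_cast rho_le i S
  have : A * (rho i S : ℝ) ≤ A * k := mul_le_mul_of_nonneg_left h1 hA
  split_ifs <;> linarith

lemma fpot_sub {hk : 0 < k} {p A D β : ℝ} {i : Fin ℓ} {x : Fin m}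
    {S T : Finset (SuperstarV k ℓ m)} (hS : GoodState i x S) (hT : GoodState i x T)
    (h : rv k ℓ m i x ∈ T ↔ rv k ℓ m i x ∈ S) :
    fpot hk p A D β i x T - fpot hk p A D β i x S
      = qpot p i x S * (hpot hk A D β i T - hpot hk A D β i S) := by
  have : qpot p i x T = qpot p i x S := by unfold qpot; simp only [h]
  unfold fpot
  rw [if_pos hS, if_pos hT, this]
  ring

/-- fitness-weighted expected change due to `u` -/
noncomputable def fdlt (r : ℝ) (hk : 0 < k) (p A D β : ℝ) (i : Fin ℓ) (x : Fin m)
    (S : Finset (SuperstarV k ℓ m)) (u : SuperstarV k ℓ m) : ℝ :=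
  (if u ∈ S then r else 1) * dlt hk p A D β i x S u

lemma bound_rv {r : ℝ} {hk : 0 < k} {p A D β : ℝ} {i : Fin ℓ} {x : Fin m}
    {S : Finset (SuperstarV k ℓ m)} (hS : GoodState i x S)
    (i' : Fin ℓ) (x' : Fin m) (hne : ¬ (i' = i ∧ x' = x)) :
    (if i' = i then (if pv k ℓ m i ⟨0, hk⟩ ∈ S then qpot p i x S * D else 0) else 0)
      ≤ fdlt r hk p A D β i x S (rv k ℓ m i' x') := by
  have hu : rv k ℓ m i' x' ∉ S := fun h => hne (good_rv hS h)
  unfold fdlt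
  rw [if_neg hu, one_mul, dlt_single (out_rv hk i' x')]
  unfold nextState
  rw [if_neg hu, fpot_sub hS (good_erase hS _) (by simp [rv, pv])]
  have hr : rho i (S.erase (pv k ℓ m i' ⟨0, hk⟩)) = rho i S := by
    apply rho_congr
    intro j hj
    have : j ≠ ⟨0, hk⟩ := by
      rintro rfl
      simp at hj
    simp [pv, this]
  split_ifs with h1 h2
  · subst h1
    unfold hpot
    rw [hr]
    simp [h2, pv, cv]
  · subst h1
    rw [Finset.erase_eq_of_notMem h2]
    simp
  · have : pv k ℓ m i' ⟨0, hk⟩ ∉ S := fun h => h1 (good_pv hS h)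
    rw [Finset.erase_eq_of_notMem this]
    simp

lemma bound_x0 {r : ℝ} (hr : 1 < r) {hk : 0 < k} {p A D β : ℝ} {i : Fin ℓ} {x : Fin m}
    (hD : 0 ≤ D)
    {S : Finset (SuperstarV k ℓ m)} (hS : GoodState i x S) :
    (if rv k ℓ m i x ∈ S ∧ pv k ℓ m i ⟨0, hk⟩ ∉ S then - (r * qpot p i x S * D) else 0)
      ≤ fdlt r hk p A D β i x S (rv k ℓ m i x) := by
  unfold fdlt
  rw [dlt_single (out_rv hk i x)]
  unfold nextState
  have hr1 : rho i (S.erase (pv k ℓ m i ⟨0, hk⟩)) = rho i S := by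
    apply rho_congr
    intro j hj
    have : j ≠ ⟨0, hk⟩ := by
      rintro rfl
      simp at hj
    simp [pv, this]
  have hr2 : rho i (insert (pv k ℓ m i ⟨0, hk⟩) S) = rho i S := by
    apply rho_congr
    intro j hj
    have : j ≠ ⟨0, hk⟩ := by
      rintro rfl
      simp at hj
    simp [pv, this]
  by_cases hu : rv k ℓ m i x ∈ S
  · simp only [hu, if_true, true_and]
    rw [fpot_sub hS (good_insert_pv hS _) (by simp [rv, pv])]
    by_cases ha : pv k ℓ m i ⟨0, hk⟩ ∈ S
    · rw [Finset.insert_eq_of_mem ha]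
      simp [ha]
    · unfold hpot
      rw [hr2]
      simp only [ha, not_false_eq_true, if_true, Finset.mem_insert, if_false]
      simp only [true_or, if_true]
      have : (cv k ℓ m = pv k ℓ m i ⟨0, hk⟩) = False := by simp [cv, pv]
      simp only [this, false_or]
      linarith
  · simp only [hu, if_false, false_and, one_mul]
    have hq : qpot p i x S = 1 := by simp [qpot, hu]
    rw [fpot_sub hS (good_erase hS _) (by simp [rv, pv]), hq]
    unfold hpot
    rw [hr1]
    simp only [Finset.mem_erase, ne_eq, not_true_eq_false, false_and, if_false]
    have : (cv k ℓ m = pv k ℓ m i ⟨0, hk⟩) = False := by simp [cv, pv]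
    simp only [this, not_false_eq_true, true_and]
    split_ifs <;> linarith

lemma hpot_insert_cv {hk : 0 < k} {A D β : ℝ} {i : Fin ℓ}
    {S : Finset (SuperstarV k ℓ m)} (hc : cv k ℓ m ∉ S) :
    hpot hk A D β i (insert (cv k ℓ m) S) - hpot hk A D β i S = - β := by
  have hr : rho i (insert (cv k ℓ m) S) = rho i S := by
    apply rho_congr
    intro j hj
    simp [pv, cv]
  unfold hpot
  rw [hr]
  have : (pv k ℓ m i ⟨0, hk⟩ = cv k ℓ m) = False := by simp [cv, pv]
  simp only [Finset.mem_insert, this, false_or, true_or, if_true, hc, if_false]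
  ring

lemma hpot_erase_cv {hk : 0 < k} {A D β : ℝ} {i : Fin ℓ}
    {S : Finset (SuperstarV k ℓ m)} (hc : cv k ℓ m ∈ S) :
    hpot hk A D β i (S.erase (cv k ℓ m)) - hpot hk A D β i S = β := by
  have hr : rho i (S.erase (cv k ℓ m)) = rho i S := by
    apply rho_congr
    intro j hj
    simp [pv, cv]
  unfold hpot
  rw [hr]
  have : (pv k ℓ m i ⟨0, hk⟩ = cv k ℓ m) = False := by simp [cv, pv]
  simp only [Finset.mem_erase, ne_eq, this, not_false_eq_true, true_and, not_true_eq_false,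
    false_and, if_false, hc, if_true]
  ring

lemma bound_pv_other {r : ℝ} {hk : 0 < k} {p A D β : ℝ} {i : Fin ℓ} {x : Fin m}
    {S : Finset (SuperstarV k ℓ m)} (hS : GoodState i x S)
    (i' : Fin ℓ) (j : Fin k) (hne : i' ≠ i) :
    (if (j : ℕ) + 1 = k then (if cv k ℓ m ∈ S then qpot p i x S * β else 0) else 0)
      ≤ fdlt r hk p A D β i x S (pv k ℓ m i' j) := by
  have hu : pv k ℓ m i' j ∉ S := fun h => hne (good_pv hS h)
  unfold fdlt
  rw [if_neg hu, one_mul]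
  by_cases hj : (j : ℕ) + 1 < k
  · rw [if_neg hj.ne, dlt_single (out_pv i' j hj)]
    unfold nextState
    have : pv k ℓ m i' ⟨j + 1, hj⟩ ∉ S := fun h => hne (good_pv hS h)
    rw [if_neg hu, Finset.erase_eq_of_notMem this]
    simp
  · rw [if_pos (by omega), dlt_single (out_pv_last i' j hj)]
    unfold nextState
    rw [if_neg hu]
    split_ifs with hc
    · rw [fpot_sub hS (good_erase hS _) (by simp [rv, cv]), hpot_erase_cv hc]
    · rw [Finset.erase_eq_of_notMem hc]
      simp

lemma hpot_erase_pv {hk : 0 < k} {A D β : ℝ} (hA : 0 ≤ A) {i : Fin ℓ}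
    {S : Finset (SuperstarV k ℓ m)} {a : Fin k} (ha : (a : ℕ) ≠ 0) :
    A * (rho i S - rho i (S.erase (pv k ℓ m i a)))
      ≤ hpot hk A D β i (S.erase (pv k ℓ m i a)) - hpot hk A D β i S := by
  have h0 : (⟨0, hk⟩ : Fin k) ≠ a := by
    rintro rfl
    simp at ha
  unfold hpot
  simp [pv, cv, h0]
  linarith

lemma hpot_insert_pv {hk : 0 < k} {A D β : ℝ} {i : Fin ℓ}
    {S : Finset (SuperstarV k ℓ m)} {a : Fin k} (ha : (a : ℕ) ≠ 0) :
    A * (rho i S - rho i (insert (pv k ℓ m i a) S))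
      = hpot hk A D β i (insert (pv k ℓ m i a) S) - hpot hk A D β i S := by
  have h0 : (⟨0, hk⟩ : Fin k) ≠ a := by
    rintro rfl
    simp at ha
  unfold hpot
  simp [pv, cv, h0]
  ring

lemma bound_pv {r : ℝ} (hr : 1 < r) {hk : 0 < k} {p A D β : ℝ} (hp : 0 ≤ p) (hA : 0 ≤ A)
    (hβ : 0 ≤ β) {i : Fin ℓ} {x : Fin m}
    {S : Finset (SuperstarV k ℓ m)} (hS : GoodState i x S) (j : Fin k) :
    (if j = ⟨0, hk⟩ then (if pv k ℓ m i ⟨0, hk⟩ ∈ S then - (r * qpot p i x S * (A * k)) else 0) else 0)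
    + (if (j : ℕ) + 1 = k then
        (if pv k ℓ m i j ∈ S ∧ cv k ℓ m ∉ S then - (r * qpot p i x S * β) else 0) else 0)
      ≤ fdlt r hk p A D β i x S (pv k ℓ m i j) := by
  have hq : 0 ≤ qpot p i x S := by unfold qpot; split_ifs <;> linarith
  have hq1 : 0 ≤ r * qpot p i x S * (A * k) := by positivity
  unfold fdlt
  by_cases hj : (j : ℕ) + 1 < k
  · rw [if_neg hj.ne, add_zero, dlt_single (out_pv i j hj)]
    unfold nextState
    by_cases hu : pv k ℓ m i j ∈ S
    · rw [if_pos hu, if_pos hu, fpot_sub hS (good_insert_pv hS _) (by simp [rv, pv]),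
        ← hpot_insert_pv (by simp)]
      by_cases hj0 : j = ⟨0, hk⟩
      · rw [if_pos hj0, if_pos (hj0 ▸ hu)]
        have h1 : (rho i (insert (pv k ℓ m i ⟨j + 1, hj⟩) S) : ℝ) ≤ k := by
          exact_mod_cast rho_le i _
        have h2 : (0 : ℝ) ≤ rho i S := by positivity
        have h3 : A * (-(k : ℝ)) ≤
            A * ((rho i S : ℝ) - rho i (insert (pv k ℓ m i ⟨j + 1, hj⟩) S)) :=
          mul_le_mul_of_nonneg_left (by linarith) hA
        have h4 : 0 ≤ r * qpot p i x S := by positivity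
        have h5 := mul_le_mul_of_nonneg_left h3 h4
        linarith
      · rw [if_neg hj0, rho_insert (j := j) _ hu rfl]
        · simp
        · rcases Nat.eq_zero_or_pos (j : ℕ) with h | h
          · exact absurd (Fin.ext h) hj0
          · exact h
    · rw [if_neg hu, if_neg hu, one_mul, fpot_sub hS (good_erase hS _) (by simp [rv, pv])]
      have h1 : (rho i (S.erase (pv k ℓ m i ⟨j + 1, hj⟩)) : ℝ) ≤ rho i S := by
        exact_mod_cast rho_mono (fun b _ hb => Finset.mem_of_mem_erase hb)
      have h2 := hpot_erase_pv (hk := hk) (A := A) (D := D) (β := β) hA (i := i) (S := S)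
        (a := ⟨j + 1, hj⟩) (by simp)
      have h3 : 0 ≤ A * ((rho i S : ℝ) - rho i (S.erase (pv k ℓ m i ⟨j + 1, hj⟩))) :=
        mul_nonneg hA (by linarith)
      have h4 := mul_nonneg hq (h3.trans h2)
      split_ifs <;> linarith
  · rw [if_pos (show (j : ℕ) + 1 = k by omega), dlt_single (out_pv_last i j hj)]
    unfold nextState
    have h0 : (if j = ⟨0, hk⟩ then (if pv k ℓ m i ⟨0, hk⟩ ∈ S then
        - (r * qpot p i x S * (A * k)) else 0) else 0) ≤ 0 := by
      split_ifs <;> linarith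
    by_cases hu : pv k ℓ m i j ∈ S
    · by_cases hc : cv k ℓ m ∈ S
      · rw [if_pos hu, if_pos hu, Finset.insert_eq_of_mem hc]
        simpa [hc] using h0
      · rw [if_pos (show pv k ℓ m i j ∈ S ∧ cv k ℓ m ∉ S from ⟨hu, hc⟩), if_pos hu, if_pos hu,
          fpot_sub hS (good_insert_cv hS) (by simp [rv, cv]), hpot_insert_cv hc]
        linarith
    · by_cases hc : cv k ℓ m ∈ S
      · rw [if_neg hu, if_neg hu, one_mul,
          fpot_sub hS (good_erase hS _) (by simp [rv, cv]), hpot_erase_cv hc]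
        have := mul_nonneg hq hβ
        simp only [hu, false_and, if_false]
        linarith
      · rw [if_neg hu, if_neg hu, Finset.erase_eq_of_notMem hc]
        simpa [hu] using h0

lemma bound_rear {r : ℝ} {hk : 0 < k} {p A D β : ℝ} (hp : 0 ≤ p) (hA : 0 ≤ A)
    {i : Fin ℓ} {x : Fin m}
    {S : Finset (SuperstarV k ℓ m)} (hS : GoodState i x S) (j : Fin k) (hj : (j : ℕ) + 1 < k)
    (hu : pv k ℓ m i j ∉ S) (hrho : rho i (S.erase (pv k ℓ m i ⟨j + 1, hj⟩)) + 1 ≤ rho i S) :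
    qpot p i x S * A ≤ fdlt r hk p A D β i x S (pv k ℓ m i j) := by
  have hq : 0 ≤ qpot p i x S := by unfold qpot; split_ifs <;> linarith
  unfold fdlt
  rw [dlt_single (out_pv i j hj)]
  unfold nextState
  rw [if_neg hu, if_neg hu, one_mul, fpot_sub hS (good_erase hS _) (by simp [rv, pv])]
  have h1 : (rho i (S.erase (pv k ℓ m i ⟨j + 1, hj⟩)) : ℝ) + 1 ≤ rho i S := by
    exact_mod_cast hrho
  have h2 := hpot_erase_pv (hk := hk) (A := A) (D := D) (β := β) hA (i := i) (S := S)
    (a := ⟨j + 1, hj⟩) (by simp)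
  refine mul_le_mul_of_nonneg_left (le_trans ?_ h2) hq
  nlinarith

lemma fpot_nonneg {hk : 0 < k} {p A D β : ℝ} (hp : 0 ≤ p) (hA : 0 ≤ A) (hD : 0 ≤ D) (hβ : 0 ≤ β)
    (hs : A * k + D + β ≤ 1 / 2) (i : Fin ℓ) (x : Fin m) (S : Finset (SuperstarV k ℓ m)) :
    0 ≤ fpot hk p A D β i x S := by
  unfold fpot
  split_ifs
  · refine mul_nonneg ?_ ?_
    · unfold qpot; split_ifs <;> linarith
    · linarith [half_le_hpot hk hA hD hβ hs i S]
  · exact le_rfl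

lemma fpot_le_one {hk : 0 < k} {p A D β : ℝ} (hp : 0 ≤ p) (hp1 : p ≤ 1)
    (hA : 0 ≤ A) (hD : 0 ≤ D) (hβ : 0 ≤ β)
    (hs : A * k + D + β ≤ 1 / 2) (i : Fin ℓ) (x : Fin m) (S : Finset (SuperstarV k ℓ m)) :
    fpot hk p A D β i x S ≤ 1 := by
  unfold fpot
  split_ifs
  · refine mul_le_one₀ ?_ ?_ ?_
    · unfold qpot; split_ifs <;> linarith
    · linarith [half_le_hpot hk hA hD hβ hs i S]
    · exact hpot_le_one hk hA hD hβ i S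
  · norm_num

lemma bound_centre_mut {r : ℝ} (hr : 1 < r) {hk : 0 < k} {p A D β : ℝ} (hp : 0 ≤ p)
    (hA : 0 ≤ A) (hD : 0 ≤ D) (hβ : 0 ≤ β)
    (hs : A * k + D + β ≤ 1 / 2) {i : Fin ℓ} {x : Fin m}
    {S : Finset (SuperstarV k ℓ m)} (hS : GoodState i x S) (hc : cv k ℓ m ∈ S) :
    - (r * qpot p i x S) ≤ fdlt r hk p A D β i x S (cv k ℓ m) := by
  have hq : 0 ≤ qpot p i x S := by unfold qpot; split_ifs <;> linarith
  unfold fdlt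
  rw [if_pos hc, dlt_centre]
  have h1 : 0 ≤ ((ℓ : ℝ) * m)⁻¹ * ∑ b : Fin ℓ × Fin m,
      fpot hk p A D β i x (nextState S (cv k ℓ m) (Sum.inl b)) :=
    mul_nonneg (by positivity) (Finset.sum_nonneg fun b _ => fpot_nonneg hp hA hD hβ hs i x _)
  have h2 : fpot hk p A D β i x S ≤ qpot p i x S := by
    unfold fpot
    rw [if_pos hS]
    exact mul_le_of_le_one_right hq (hpot_le_one hk hA hD hβ i S)
  nlinarith

lemma bound_centre {r : ℝ} {hk : 0 < k} {p A D β : ℝ} (hp1 : p ≤ 1)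
    (hA : 0 ≤ A) (hD : 0 ≤ D) (hβ : 0 ≤ β)
    (hs : A * k + D + β ≤ 1 / 2) {i : Fin ℓ} {x : Fin m}
    {S : Finset (SuperstarV k ℓ m)} (hS : GoodState i x S) (hc : cv k ℓ m ∉ S) :
    (if rv k ℓ m i x ∈ S then (1 - p) / 2 * ((ℓ : ℝ) * m)⁻¹ else 0)
      ≤ fdlt r hk p A D β i x S (cv k ℓ m) := by
  have hℓ : (0 : ℝ) < ℓ := by exact_mod_cast i.pos
  have hm : (0 : ℝ) < m := by exact_mod_cast x.pos
  unfold fdlt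
  rw [if_neg hc, one_mul, dlt_centre]
  have hpt : ∀ b : Fin ℓ × Fin m, fpot hk p A D β i x S
      + (if b = (i, x) then (if rv k ℓ m i x ∈ S then (1 - p) / 2 else 0) else 0)
      ≤ fpot hk p A D β i x (nextState S (cv k ℓ m) (Sum.inl b)) := by
    rintro ⟨i', x'⟩
    unfold nextState
    rw [if_neg hc]
    by_cases hb : rv k ℓ m i' x' ∈ S
    · obtain ⟨rfl, rfl⟩ := good_rv hS hb
      rw [if_pos rfl, if_pos hb]
      unfold fpot
      rw [if_pos hS, if_pos (good_erase hS _)]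
      have h1 : qpot p i' x' S = p := by simp [qpot, hb]
      have h2 : qpot p i' x' (S.erase (Sum.inl (i', x'))) = 1 := by simp [qpot]
      have h3 : hpot hk A D β i' (S.erase (Sum.inl (i', x'))) = hpot hk A D β i' S := by
        have : rho i' (S.erase (Sum.inl (i', x'))) = rho i' S :=
          rho_congr fun j hj => by simp [pv]
        unfold hpot
        rw [this]
        simp [pv, cv]
      rw [h1, h2, h3]
      have := half_le_hpot hk hA hD hβ hs i' S
      nlinarith
    · rw [Finset.erase_eq_of_notMem hb]
      have : (if (i', x') = (i, x) then (if rv k ℓ m i x ∈ S then (1 - p) / 2 else 0) else 0)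
          = 0 := by
        split_ifs with h1 h2
        · simp only [Prod.mk.injEq] at h1
          obtain ⟨rfl, rfl⟩ := h1
          exact absurd h2 hb
        · rfl
        · rfl
      rw [this, add_zero]
  have hsum := Finset.sum_le_sum fun b (_ : b ∈ (Finset.univ : Finset (Fin ℓ × Fin m))) => hpt b
  rw [Finset.sum_add_distrib, Finset.sum_ite_eq' Finset.univ (i, x)] at hsum
  simp only [Finset.sum_const, Finset.card_univ, Fintype.card_prod, Fintype.card_fin,
    Finset.mem_univ, if_true, nsmul_eq_mul, Nat.cast_mul] at hsum
  have h5 := mul_le_mul_of_nonneg_left hsum (show (0:ℝ) ≤ ((ℓ : ℝ) * m)⁻¹ by positivity)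
  rw [mul_add, inv_mul_cancel_left₀ (by positivity)] at h5
  split_ifs at h5 ⊢ <;> linarith

lemma sum_fin_ite {N : ℕ} (y₀ : Fin N) (P Q : ℝ) :
    ∑ y : Fin N, (if y = y₀ then P else Q) = P + ((N : ℝ) - 1) * Q := by
  have : ∀ y : Fin N, (if y = y₀ then P else Q) = Q + (if y = y₀ then P - Q else 0) := by
    intro y; split_ifs <;> ring
  simp_rw [this]
  rw [Finset.sum_add_distrib, Finset.sum_ite_eq' Finset.univ y₀]
  simp
  ring

lemma sum_reservoir {r : ℝ} (hr : 1 < r) {hk : 0 < k} {p A D β : ℝ} {i : Fin ℓ} {x : Fin m}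
    (hD : 0 ≤ D) {S : Finset (SuperstarV k ℓ m)} (hS : GoodState i x S) :
    (if rv k ℓ m i x ∈ S ∧ pv k ℓ m i ⟨0, hk⟩ ∉ S then - (r * qpot p i x S * D) else 0)
      + ((m : ℝ) - 1) * (if pv k ℓ m i ⟨0, hk⟩ ∈ S then qpot p i x S * D else 0)
      ≤ ∑ b : Fin ℓ × Fin m, fdlt r hk p A D β i x S (Sum.inl b) := by
  rw [← sum_fin_ite x, Fintype.sum_prod_type]
  set Y := fun x' : Fin m => (if x' = x then
    (if rv k ℓ m i x ∈ S ∧ pv k ℓ m i ⟨0, hk⟩ ∉ S then - (r * qpot p i x S * D) else 0)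
    else (if pv k ℓ m i ⟨0, hk⟩ ∈ S then qpot p i x S * D else 0)) with hY
  have h1 : ∑ x', Y x' = ∑ i' : Fin ℓ, (if i' = i then ∑ x', Y x' else 0) := by simp
  rw [h1]
  refine Finset.sum_le_sum fun i' _ => ?_
  have h2 : (if i' = i then ∑ x', Y x' else 0) = ∑ x', (if i' = i then Y x' else 0) := by
    split_ifs <;> simp
  rw [h2]
  refine Finset.sum_le_sum fun x' _ => ?_
  by_cases hb : i' = i ∧ x' = x
  · obtain ⟨rfl, rfl⟩ := hb
    simp only [hY, if_true]
    exact bound_x0 hr hD hS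
  · have := bound_rv (r := r) (hk := hk) (p := p) (A := A) (D := D) (β := β) hS i' x' hb
    refine le_trans ?_ this
    by_cases hi : i' = i
    · have hx : x' ≠ x := fun h => hb ⟨hi, h⟩
      simp [hi, hY, hx]
    · simp [hi]

lemma sum_path_own {r : ℝ} (hr : 1 < r) {hk : 0 < k} {p A D β : ℝ} (hp : 0 ≤ p) (hA : 0 ≤ A)
    (hβ : 0 ≤ β) {i : Fin ℓ} {x : Fin m}
    {S : Finset (SuperstarV k ℓ m)} (hS : GoodState i x S) (E : Fin k → ℝ)
    (hE : ∀ j, E j ≠ 0 → E j ≤ fdlt r hk p A D β i x S (pv k ℓ m i j) ∧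
      (j : ℕ) + 1 < k ∧ pv k ℓ m i j ∉ S) :
    (if pv k ℓ m i ⟨0, hk⟩ ∈ S then - (r * qpot p i x S * (A * k)) else 0)
    + (if pv k ℓ m i ⟨k - 1, by omega⟩ ∈ S ∧ cv k ℓ m ∉ S then - (r * qpot p i x S * β) else 0)
    + ∑ j, E j
      ≤ ∑ j : Fin k, fdlt r hk p A D β i x S (pv k ℓ m i j) := by
  set a : ℝ := (if pv k ℓ m i ⟨0, hk⟩ ∈ S then - (r * qpot p i x S * (A * k)) else 0) with ha
  set l : ℝ := (if pv k ℓ m i ⟨k - 1, by omega⟩ ∈ S ∧ cv k ℓ m ∉ S then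
    - (r * qpot p i x S * β) else 0) with hl
  have h1 : a = ∑ j : Fin k, (if j = ⟨0, hk⟩ then a else 0) := by simp
  have h2 : l = ∑ j : Fin k, (if j = ⟨k - 1, by omega⟩ then l else 0) := by simp
  rw [h1, h2, ← Finset.sum_add_distrib, ← Finset.sum_add_distrib]
  refine Finset.sum_le_sum fun j _ => ?_
  by_cases hEj : E j = 0
  · rw [hEj, add_zero]
    have := bound_pv hr (hk := hk) (D := D) hp hA hβ hS j
    refine le_trans (le_of_eq ?_) this
    congr 1
    by_cases hj : j = ⟨k - 1, by omega⟩
    · have hj' : (j : ℕ) + 1 = k := by rw [hj]; simp; omega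
      rw [if_pos hj, if_pos hj', hl, hj]
    · have hj' : ¬ (j : ℕ) + 1 = k := fun h => hj (Fin.ext (by simp; omega))
      rw [if_neg hj, if_neg hj']
  · obtain ⟨h3, h4, h5⟩ := hE j hEj
    have h6 : (if j = ⟨0, hk⟩ then a else 0) = 0 := by
      split_ifs with h
      · rw [ha, if_neg (h ▸ h5)]
      · rfl
    have h7 : j ≠ ⟨k - 1, by omega⟩ := by
      intro h
      rw [h] at h4
      simp at h4
      omega
    rw [h6, if_neg h7]
    linarith

lemma sum_path {r : ℝ} {hk : 0 < k} {p A D β : ℝ} {i : Fin ℓ} {x : Fin m}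
    {S : Finset (SuperstarV k ℓ m)} (hS : GoodState i x S) :
    ∑ j : Fin k, fdlt r hk p A D β i x S (pv k ℓ m i j)
      + ((ℓ : ℝ) - 1) * (if cv k ℓ m ∈ S then qpot p i x S * β else 0)
      ≤ ∑ b : Fin ℓ × Fin k, fdlt r hk p A D β i x S (Sum.inr (Sum.inl b)) := by
  rw [← sum_fin_ite i, Fintype.sum_prod_type]
  refine Finset.sum_le_sum fun i' _ => ?_
  split_ifs with hi hc
  · rw [hi]
  · have h1 : qpot p i x S * β
        = ∑ j : Fin k, (if j = ⟨k - 1, by omega⟩ then qpot p i x S * β else 0) := by simp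
    rw [h1]
    refine Finset.sum_le_sum fun j _ => ?_
    refine le_trans (le_of_eq ?_) (bound_pv_other hS i' j hi)
    rw [if_pos hc]
    by_cases hj : j = ⟨k - 1, by omega⟩
    · have hj' : (j : ℕ) + 1 = k := by rw [hj]; simp; omega
      rw [if_pos hj, if_pos hj']
    · have hj' : ¬ (j : ℕ) + 1 = k := fun h => hj (Fin.ext (by simp; omega))
      rw [if_neg hj, if_neg hj']
  · refine Finset.sum_nonneg fun j _ => ?_
    refine le_trans (le_of_eq ?_) (bound_pv_other hS i' j hi)
    simp [hc]

lemma drift_pos {r : ℝ} (hr : 1 < r) {hk : 0 < k} {p A D β : ℝ} {i : Fin ℓ} {x : Fin m}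
    (hp : 0 < p) (hp1 : p ≤ 1) (hA : 0 < A) (hD : 0 ≤ D) (hβ : 0 ≤ β)
    (hs : A * k + D + β ≤ 1 / 2)
    (c1 : r * β < A) (c2 : r * (A * k) + r * β < (m - 1) * D)
    (c3 : r + r * D < (ℓ - 1) * β)
    (c4 : r * p * D < (1 - p) / 2 * ((ℓ : ℝ) * m)⁻¹)
    {S : Finset (SuperstarV k ℓ m)} (hS : GoodState i x S) (hne : S ≠ ∅) :
    0 < ∑ u, fdlt r hk p A D β i x S u := by
  rw [Fintype.sum_sum_type, Fintype.sum_sum_type]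
  have hcs : ∑ c : Unit, fdlt r hk p A D β i x S (Sum.inr (Sum.inr c))
      = fdlt r hk p A D β i x S (cv k ℓ m) := by simp
  rw [hcs]
  have hR := sum_reservoir (k := k) hr (hk := hk) (p := p) (A := A) (β := β) hD hS
  have hP := sum_path (r := r) (hk := hk) (p := p) (A := A) (D := D) (β := β) hS
  have hO := sum_path_own hr (hk := hk) (D := D) hp.le hA.le hβ hS (fun _ => 0) (by simp)
  have hrear : pv k ℓ m i ⟨0, hk⟩ ∉ S → (∃ j, pv k ℓ m i j ∈ S) → qpot p i x S * A +
      (if pv k ℓ m i ⟨k - 1, by omega⟩ ∈ S ∧ cv k ℓ m ∉ S then - (r * qpot p i x S * β) else 0)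
      ≤ ∑ j : Fin k, fdlt r hk p A D β i x S (pv k ℓ m i j) := by
    intro h0 h1
    obtain ⟨j0, hj0, hj0S, hrho⟩ := exists_rear hk h0 h1
    have := sum_path_own hr (hk := hk) (D := D) hp.le hA.le hβ hS
      (fun j => if j = j0 then qpot p i x S * A else 0) (by
        intro j hj
        have : j = j0 := by
          by_contra h
          simp [h] at hj
        subst this
        rw [if_pos rfl]
        exact ⟨bound_rear hp.le hA.le hS j hj0 hj0S hrho, hj0, hj0S⟩)
    rw [if_neg h0, Finset.sum_ite_eq' Finset.univ j0] at this
    simp only [Finset.mem_univ, if_true] at this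
    linarith
  simp only [Finset.sum_const_zero, add_zero] at hO
  have hq0 : 0 < qpot p i x S := by unfold qpot; split_ifs <;> linarith
  have hqX : rv k ℓ m i x ∈ S → qpot p i x S = p := fun h => by simp [qpot, h]
  set q := qpot p i x S
  have e1 := mul_lt_mul_of_pos_left c1 hq0
  have e2 := mul_lt_mul_of_pos_left c2 hq0
  have e3 := mul_lt_mul_of_pos_left c3 hq0
  have e4 : 0 ≤ q * (r * β) := by positivity
  have e5 : 0 ≤ q * (r * D) := by positivity
  have e6 : 0 < q * A := by positivity
  by_cases hc : cv k ℓ m ∈ S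
  · have hC := bound_centre_mut hr (hk := hk) hp.le hA.le hD hβ hs hS hc
    simp only [hc, if_true, not_true_eq_false, and_false, if_false, add_zero] at hP hO hC
    by_cases ha : pv k ℓ m i ⟨0, hk⟩ ∈ S
    · simp only [ha, not_true_eq_false, and_false, if_false, if_true] at hR hO
      linarith
    · simp only [ha, not_false_eq_true, and_true, if_false] at hR hO
      split_ifs at hR <;> linarith
  · have hC := bound_centre (r := r) (hk := hk) hp1 hA.le hD hβ hs hS hc
    have hC0 : 0 ≤ fdlt r hk p A D β i x S (cv k ℓ m) := by
      refine le_trans ?_ hC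
      split_ifs
      · have : 0 ≤ 1 - p := by linarith
        positivity
      · exact le_rfl
    simp only [hc, if_false, not_false_eq_true, and_true, mul_zero, add_zero] at hP hO hrear
    by_cases ha : pv k ℓ m i ⟨0, hk⟩ ∈ S
    · simp only [ha, not_true_eq_false, and_false, if_false, if_true] at hR hO
      split_ifs at hO <;> linarith
    · simp only [ha, not_false_eq_true, and_true, if_false, mul_zero, add_zero, zero_add] at hR hO
      have hrear' := hrear ha
      by_cases hX : rv k ℓ m i x ∈ S
      · rw [if_pos hX] at hR hC
        have hq := hqX hX
        rw [hq] at hR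
        by_cases hl : ∃ j, pv k ℓ m i j ∈ S
        · have := hrear' hl
          split_ifs at this <;> linarith
        · rw [if_neg (fun h => hl ⟨_, h⟩)] at hO
          linarith
      · rw [if_neg hX] at hR
        have hl : ∃ j, pv k ℓ m i j ∈ S := by
          obtain ⟨u, hu⟩ := Finset.nonempty_iff_ne_empty.2 hne
          rcases hS u hu with h | ⟨j, h⟩ | h
          · exact absurd (h ▸ hu) hX
          · exact ⟨j, h ▸ hu⟩
          · exact absurd (h ▸ hu) hc
        have := hrear' hl
        split_ifs at this <;> linarith

lemma ext_bound {r : ℝ} (hr : 1 < r) (hk : 0 < k) {p A D β : ℝ} (i : Fin ℓ) (x : Fin m)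
    (hp : 0 < p) (hp1 : p ≤ 1) (hA : 0 < A) (hD : 0 ≤ D) (hβ : 0 ≤ β)
    (hs : A * k + D + β ≤ 1 / 2)
    (c1 : r * β < A) (c2 : r * (A * k) + r * β < (m - 1) * D)
    (c3 : r + r * D < (ℓ - 1) * β)
    (c4 : r * p * D < (1 - p) / 2 * ((ℓ : ℝ) * m)⁻¹) :
    p ≤ extinctionProb r (outWeights (superstarOut k ℓ m)) (pointInit (rv k ℓ m i x)) := by
  have hgood : GoodState i x ({rv k ℓ m i x} : Finset (SuperstarV k ℓ m)) := by
    intro u hu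
    exact Or.inl (Finset.mem_singleton.1 hu)
  have hval : fpot hk p A D β i x {rv k ℓ m i x} = p := by
    unfold fpot
    rw [if_pos hgood]
    simp [qpot, hpot, rho, rv, pv, cv]
  have hW := outWeights_nonneg (superstarOut k ℓ m)
  have hrow := superstar_row (k := k) i.pos x.pos
  have h := le_extinctionProb hr hW hrow (rv k ℓ m i x) (fpot hk p A D β i x)
    (fpot_nonneg hp.le hA.le hD hβ hs i x) (fpot_le_one hp.le hp1 hA.le hD hβ hs i x) ?_ ?_
  · rwa [hval] at h
  · rw [stepExp_eq]
    simp only [nextState, Finset.notMem_empty, if_false, Finset.erase_empty, one_mul]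
    simp_rw [← Finset.sum_mul, hrow]
    have h1 : (∑ _u : SuperstarV k ℓ m, (1 : ℝ)) = moranW r (∅ : Finset (SuperstarV k ℓ m)) := by
      simp [moranW]
    rw [h1, mul_div_cancel_left₀ _ (moranW_pos hr _).ne']
  · intro S hne hpos
    have hS : GoodState i x S := by
      by_contra h
      unfold fpot at hpos
      rw [if_neg h] at hpos
      exact lt_irrefl _ hpos
    exact drift_of_sum_pos hr _ S (drift_pos hr (hk := hk) hp hp1 hA hD hβ hs c1 c2 c3 c4 hS hne)

end SuperstarPotential

set_option maxHeartbeats 1000000 in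
/-- **Extinction lower bound for superstars, difficult regime** (Lemma 4.5).  For every
`r > 1` there is an `n₀` such that for all positive integers `k`, `ℓ`, `m` with
`n = ℓ(k+m)+1 ≥ n₀`, letting `κ = max{3k, 70·r⁴·log n}`, if `ℓ ≥ 70·r⁴·κ·log n` and
`m ≥ 6·r²·κ`, then for every fixed initial mutant `x₀` lying in a reservoir, the
discrete-time Moran process with fitness `r` on the `(k,ℓ,m)`-superstar started from
`{x₀}` has extinction probability at least `1/(490·r⁴·κ)`. -/
theorem superstar_extinction_difficult_regime (r : ℝ) (hr : 1 < r) :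
    ∃ n₀ : ℕ, ∀ k ℓ m : ℕ, 0 < k → 0 < ℓ → 0 < m →
      ∀ n : ℕ, n = ℓ * (k + m) + 1 → n₀ ≤ n →
        ∀ κ : ℝ, κ = max (3 * (k : ℝ)) (70 * r ^ 4 * Real.log (n : ℝ)) →
          70 * r ^ 4 * κ * Real.log (n : ℝ) ≤ (ℓ : ℝ) →
          6 * r ^ 2 * κ ≤ (m : ℝ) →
          ∀ x₀ : SuperstarV k ℓ m, (∃ i x, x₀ = Sum.inl (i, x)) →
            1 / (490 * r ^ 4 * κ) ≤
              extinctionProb r (outWeights (superstarOut k ℓ m)) (pointInit x₀) := by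
  refine ⟨3, ?_⟩
  intro k ℓ m hk hℓ hm n hn hn3 κ hκ hℓκ hmκ x₀ hx₀
  obtain ⟨i, x, rfl⟩ := hx₀
  have hn3' : (3 : ℝ) ≤ n := by exact_mod_cast hn3
  have hlog : 1 ≤ Real.log n := by
    rw [Real.le_log_iff_exp_le (by linarith)]
    linarith [Real.exp_one_lt_d9]
  have hk1 : (1 : ℝ) ≤ k := by exact_mod_cast hk
  have hκk : 3 * (k : ℝ) ≤ κ := by rw [hκ]; exact le_max_left _ _
  have hκ0 : 0 < κ := by linarith
  have hr2 : 1 ≤ r ^ 2 := one_le_pow₀ hr.le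
  have hr4 : r ^ 2 ≤ r ^ 4 := pow_le_pow_right₀ hr.le (by norm_num)
  have hrr : r ≤ r ^ 2 := by nlinarith
  have hr0 : 0 < r := by linarith
  -- ℓ ≥ 210 r^2 k
  have hL : 210 * (r ^ 2 * k) ≤ (ℓ : ℝ) := by
    have h1 : r ^ 2 * (3 * k) ≤ r ^ 4 * κ := mul_le_mul hr4 hκk (by positivity) (by positivity)
    have h2 : 70 * r ^ 4 * κ * 1 ≤ 70 * r ^ 4 * κ * Real.log n :=
      mul_le_mul_of_nonneg_left hlog (by positivity)
    linarith
  have hM : 18 * (r ^ 2 * k) ≤ (m : ℝ) := by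
    have h1 : r ^ 2 * (3 * k) ≤ r ^ 2 * κ := mul_le_mul_of_nonneg_left hκk (by positivity)
    linarith
  have hrk : r ^ 2 ≤ r ^ 2 * k := le_mul_of_one_le_right (by positivity) hk1
  have hkr : (k : ℝ) ≤ r ^ 2 * k := le_mul_of_one_le_left (by positivity) hr2
  have hm1 : (17 : ℝ) * (r ^ 2 * k) ≤ m - 1 := by linarith
  have hm0 : (0 : ℝ) < m - 1 := by linarith
  have hℓ0 : (0 : ℝ) < ℓ := by linarith
  have hℓ210 : (210 : ℝ) ≤ ℓ := by linarith
  have hm18 : (18 : ℝ) ≤ m := by linarith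
  have hβ : 0 < 2 * r / ℓ := by positivity
  have hA : 0 < 4 * r ^ 2 / ℓ := by positivity
  have hD : 0 < 8 * r ^ 3 * k / (ℓ * (m - 1)) := by positivity
  have hAk : 4 * r ^ 2 / ℓ * k ≤ 4 / 210 := by
    rw [div_mul_eq_mul_div, div_le_iff₀ hℓ0]
    linarith
  have hβs : 2 * r / ℓ ≤ 2 / 210 := by
    rw [div_le_iff₀ hℓ0]
    linarith
  have hDs : r * (8 * r ^ 3 * k / (ℓ * (m - 1))) ≤ 1 / 100 := by
    rw [← mul_div_assoc, div_le_iff₀ (by positivity)]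
    have : (210 * (r ^ 2 * k)) * (17 * (r ^ 2 * k)) ≤ ℓ * (m - 1) :=
      mul_le_mul hL hm1 (by positivity) hℓ0.le
    have h3 : r ^ 4 * k * 1 ≤ r ^ 4 * k * k := mul_le_mul_of_nonneg_left hk1 (by positivity)
    nlinarith
  have hDs' : 8 * r ^ 3 * k / (ℓ * (m - 1)) ≤ 1 / 100 := by nlinarith
  have hr4κ : 3 ≤ r ^ 4 * κ := by nlinarith
  have hpk : 1 / (490 * r ^ 4 * κ) * (1470 * (r ^ 4 * k)) ≤ 1 := by
    rw [one_div_mul_eq_div, div_le_one (by positivity)]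
    have := mul_le_mul_of_nonneg_left hκk (show 0 ≤ r ^ 4 by positivity)
    linarith
  have hps : 1 / (490 * r ^ 4 * κ) ≤ 1 / 1470 := by
    apply one_div_le_one_div_of_le (by norm_num)
    linarith
  have hp : 0 < 1 / (490 * r ^ 4 * κ) := by positivity
  set p := 1 / (490 * r ^ 4 * κ)
  clear_value p
  clear hκ hℓκ hmκ hn
  refine ext_bound hr hk (A := 4 * r ^ 2 / ℓ) (D := 8 * r ^ 3 * k / (ℓ * (m - 1)))
    (β := 2 * r / ℓ) i x hp ?_ hA hD.le hβ.le ?_ ?_ ?_ ?_ ?_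
  · linarith
  · linarith
  · rw [← mul_div_assoc, div_lt_div_iff_of_pos_right hℓ0]
    nlinarith
  · have h1 : ((m : ℝ) - 1) * (8 * r ^ 3 * k / (ℓ * (m - 1))) = 8 * r ^ 3 * k / ℓ := by
      field_simp
    have h2 : r * (4 * r ^ 2 / ℓ * k) + r * (2 * r / ℓ) = (4 * r ^ 3 * k + 2 * r ^ 2) / ℓ := by
      field_simp
    rw [h1, h2, div_lt_div_iff_of_pos_right hℓ0]
    have : r ^ 2 * 1 ≤ r ^ 3 * k := 
      mul_le_mul (pow_le_pow_right₀ hr.le (by norm_num)) hk1 (by norm_num) (by positivity)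
    nlinarith
  · have h1 : ((ℓ : ℝ) - 1) * (2 * r / ℓ) = 2 * r - 2 * r / ℓ := by
      field_simp
    rw [h1]
    linarith
  · have h1 : r * p * (8 * r ^ 3 * k / (ℓ * (m - 1)))
        = (p * (1470 * (r ^ 4 * k))) * (8 / 1470 / (ℓ * (m - 1))) := by
      field_simp
    have h2 : (p * (1470 * (r ^ 4 * k))) * (8 / 1470 / (ℓ * (m - 1)))
        ≤ 1 * (8 / 1470 / (ℓ * (m - 1))) :=
      mul_le_mul_of_nonneg_right hpk (by positivity)
    have h3 : (1 : ℝ) * (8 / 1470 / (ℓ * (m - 1))) < 1 / 4 * ((ℓ : ℝ) * m)⁻¹ := by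
      rw [one_mul, div_div, ← div_eq_mul_inv, div_div, div_lt_div_iff₀ (by positivity) (by positivity)]
      nlinarith
    have h4 : 1 / 4 * ((ℓ : ℝ) * m)⁻¹ ≤ (1 - p) / 2 * ((ℓ : ℝ) * m)⁻¹ :=
      mul_le_mul_of_nonneg_right (by linarith) (by positivity)
    linarith
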